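/- Let H be a real Hilbert space, F ⊂ H compact, and (f_n)_{n≥1} a greedy sequence for F with associated quantities σ_n and Kolmogorov widths d_n. For all a > 0 and α > 0 there exist constants c > 0, β > 0 and C > 0 such that: if d_0 > 0 and d_I ≤ d_0 · e^{−a I^{α}} for all I ≥ 1, then σ_I ≤ C · d_0 · e^{−c I^{β}} for all I ≥ 1. -/

import Mathlib

open Metric Set

/-- `σ_n := sup_{x ∈ F} dist(x, span{f 1, …, f n})`. -/
noncomputable def greedySigma {H : Type*} [NormedAddCommGroup H] [InnerProductSpace ℝ H]
    (F : Set H) (f : ℕ → H) (n : ℕ) : ℝ :=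
  ⨆ x ∈ F, Metric.infDist x (Submodule.span ℝ (f '' Set.Icc 1 n) : Set H)

/-- A greedy sequence for `F`: `f (n+1) ∈ F` maximizes the distance to the span of the
previously selected elements over `F`. -/
def IsGreedy {H : Type*} [NormedAddCommGroup H] [InnerProductSpace ℝ H]
    (F : Set H) (f : ℕ → H) : Prop :=
  ∀ n : ℕ, f (n + 1) ∈ F ∧ ∀ x ∈ F,
    Metric.infDist x (Submodule.span ℝ (f '' Set.Icc 1 n) : Set H) ≤
      Metric.infDist (f (n + 1)) (Submodule.span ℝ (f '' Set.Icc 1 n) : Set H)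

/-- Kolmogorov `I`-width of `F`: the infimum over all subspaces `V` of dimension at most `I`
of `sup_{x ∈ F} dist(x, V)`. -/
noncomputable def kolWidth {H : Type*} [NormedAddCommGroup H] [InnerProductSpace ℝ H]
    (F : Set H) (I : ℕ) : ℝ :=
  ⨅ V : {V : Submodule ℝ H // FiniteDimensional ℝ V ∧ Module.finrank ℝ V ≤ I},
    ⨆ x ∈ F, Metric.infDist x ((V : Submodule ℝ H) : Set H)

open scoped Nat

section GreedyDecay

variable {H : Type*} [NormedAddCommGroup H] [InnerProductSpace ℝ H]

lemma norm_sub_starProjection_eq_infDist (K : Submodule ℝ H) [K.HasOrthogonalProjection] (x : H) :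
    ‖x - K.starProjection x‖ = infDist x (K : Set H) := by
  rw [Submodule.starProjection_minimal, infDist_eq_iInf]
  simp only [dist_eq_norm]
  rfl

lemma infDist_submodule_le_norm (K : Submodule ℝ H) (x : H) : infDist x (K : Set H) ≤ ‖x‖ := by
  simpa using infDist_le_dist_of_mem (x := x) K.zero_mem

/-- The distance to a subspace is attained by pairing with a vector of norm at most one
orthogonal to that subspace. -/
lemma exists_orthogonal_inner_eq_infDist (K : Submodule ℝ H) [K.HasOrthogonalProjection] (x : H) :
    ∃ g : H, ‖g‖ ≤ 1 ∧ (∀ y ∈ K, inner ℝ y g = 0) ∧ inner ℝ x g = infDist x (K : Set H) := by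
  set e := x - K.starProjection x with he
  have hort : ∀ y ∈ K, inner ℝ y e = 0 :=
    (Submodule.mem_orthogonal K e).1 (K.sub_starProjection_mem_orthogonal x)
  have hxe : inner ℝ x e = ‖e‖ * ‖e‖ := by
    rw [← real_inner_self_eq_norm_mul_norm]
    have h := hort _ (K.starProjection_apply_mem x)
    nth_rewrite 2 [he]
    rw [inner_sub_left, h, sub_zero]
  refine ⟨‖e‖⁻¹ • e, ?_, fun y hy => ?_, ?_⟩
  · rw [norm_smul, norm_inv, norm_norm]
    exact inv_mul_le_one
  · rw [inner_smul_right, hort y hy, mul_zero]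
  · rw [inner_smul_right, hxe, ← norm_sub_starProjection_eq_infDist, ← he]
    rcases eq_or_ne ‖e‖ 0 with h | h
    · simp [h]
    · field_simp

/-- The alternating map sending `x` to the determinant of the matrix `⟪x i, g j⟫`. -/
noncomputable def innerDet {n : ℕ} (g : Fin n → H) : H [⋀^Fin n]→ₗ[ℝ] ℝ :=
  (Matrix.detRowAlternating (R := ℝ) (n := Fin n)).compLinearMap
    (LinearMap.pi fun j => (innerₗ H).flip (g j))

lemma innerDet_apply {n : ℕ} (g x : Fin n → H) :
    innerDet g x = (Matrix.of fun i j => inner ℝ (x i) (g j)).det := rfl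

lemma abs_innerDet_le {n : ℕ} {g : Fin n → H} (hg : ∀ j, ‖g j‖ ≤ 1) (x : Fin n → H) :
    |innerDet g x| ≤ n ! * ∏ i, ‖x i‖ := by
  rw [innerDet_apply, ← Matrix.det_transpose, Matrix.det_apply']
  refine (Finset.abs_sum_le_sum_abs _ _).trans ?_
  have key : ∀ τ ∈ (Finset.univ : Finset (Equiv.Perm (Fin n))),
      |((Equiv.Perm.sign τ : ℤ) : ℝ) * ∏ i, (Matrix.of fun i j => inner ℝ (x i) (g j)).transpose
        (τ i) i| ≤ ∏ i, ‖x i‖ := by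
    intro τ _
    rw [abs_mul, ← Int.cast_abs, Int.isUnit_iff_abs_eq.1 (Units.isUnit _), Int.cast_one, one_mul,
      Finset.abs_prod]
    refine Finset.prod_le_prod (fun _ _ => abs_nonneg _) fun i _ => ?_
    exact (abs_real_inner_le_norm _ _).trans
      (mul_le_of_le_one_right (norm_nonneg _) (hg _))
  refine (Finset.sum_le_card_nsmul _ _ _ key).trans ?_
  simp [Fintype.card_perm]

/-- Determinant estimate: splitting each vector along a subspace of dimension at most `m`,
at most `m` of the summands of the multilinear expansion can come from that subspace. -/
lemma abs_innerDet_le_of_finrank_le {n m : ℕ} (hmn : m ≤ n) {g : Fin n → H}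
    (hg : ∀ j, ‖g j‖ ≤ 1) (x : Fin n → H) (V : Submodule ℝ H) [FiniteDimensional ℝ V]
    (hV : Module.finrank ℝ V ≤ m) {R ε : ℝ} (hε : 0 ≤ ε) (hεR : ε ≤ R)
    (hxR : ∀ i, ‖x i‖ ≤ R) (hxε : ∀ i, infDist (x i) (V : Set H) ≤ ε) :
    |innerDet g x| ≤ 2 ^ n * (n ! * (R ^ m * ε ^ (n - m))) := by
  classical
  set v : Fin n → H := fun i => V.starProjection (x i) with hv
  set e : Fin n → H := fun i => x i - V.starProjection (x i) with he
  have hR : 0 ≤ R := hε.trans hεR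
  have hx : x = v + e := by ext i; simp [v, e]
  have hterm : ∀ s ∈ (Finset.univ : Finset (Finset (Fin n))),
      |innerDet g (s.piecewise v e)| ≤ n ! * (R ^ m * ε ^ (n - m)) := by
    intro s _
    by_cases hs : s.card ≤ m
    · refine (abs_innerDet_le hg _).trans ?_
      gcongr
      calc ∏ i, ‖s.piecewise v e i‖ ≤ ∏ i, s.piecewise (fun _ => R) (fun _ => ε) i := by
            refine Finset.prod_le_prod (fun _ _ => norm_nonneg _) fun i _ => ?_
            by_cases hi : i ∈ s
            · simpa [hi, v] using (V.norm_starProjection_apply_le _).trans (hxR i)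
            · simpa [hi, e, norm_sub_starProjection_eq_infDist] using hxε i
        _ = R ^ s.card * (ε ^ (m - s.card) * ε ^ (n - m)) := by
            rw [Finset.prod_piecewise, ← pow_add]
            have : m - s.card + (n - m) = n - s.card := by omega
            simp [this, Finset.card_sdiff]
        _ ≤ R ^ s.card * (R ^ (m - s.card) * ε ^ (n - m)) := by gcongr
        _ = R ^ m * ε ^ (n - m) := by
            rw [← mul_assoc, ← pow_add, Nat.add_sub_cancel' hs]
    · have hdep : ¬ LinearIndependent ℝ (s.piecewise v e) := by
        intro hli
        have h1 : LinearIndependent ℝ (fun i : s => V.orthogonalProjectionOnto (x i)) := by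
          refine LinearIndependent.of_comp V.subtype ?_
          have h2 := hli.comp ((↑) : s → Fin n) Subtype.val_injective
          convert h2 using 1
          ext i
          simp [v]
        have h3 := h1.fintype_card_le_finrank
        rw [Fintype.card_coe] at h3
        omega
      rw [AlternatingMap.map_linearDependent _ _ hdep, abs_zero]
      positivity
  rw [hx, AlternatingMap.map_add_univ]
  refine (Finset.abs_sum_le_sum_abs _ _).trans ((Finset.sum_le_card_nsmul _ _ _ hterm).trans ?_)
  simp

/-- The product of the successive distances `dist(f (i+1), span{f 1, …, f i})` is controlled by
any subspace of dimension at most `m` approximating the vectors `f (i+1)`. -/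
lemma prod_infDist_span_le {n m : ℕ} (hmn : m ≤ n) (f : ℕ → H) (V : Submodule ℝ H)
    [FiniteDimensional ℝ V] (hV : Module.finrank ℝ V ≤ m) {R ε : ℝ} (hε : 0 ≤ ε) (hεR : ε ≤ R)
    (hfR : ∀ i, ‖f (i + 1)‖ ≤ R) (hfε : ∀ i, infDist (f (i + 1)) (V : Set H) ≤ ε) :
    ∏ i ∈ Finset.range n, infDist (f (i + 1)) (Submodule.span ℝ (f '' Icc 1 i) : Set H) ≤
      2 ^ n * (n ! * (R ^ m * ε ^ (n - m))) := by
  have hex : ∀ i : ℕ, ∃ g : H, ‖g‖ ≤ 1 ∧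
      (∀ y ∈ Submodule.span ℝ (f '' Icc 1 i), inner ℝ y g = 0) ∧
      inner ℝ (f (i + 1)) g = infDist (f (i + 1)) (Submodule.span ℝ (f '' Icc 1 i) : Set H) := by
    intro i
    have : FiniteDimensional ℝ (Submodule.span ℝ (f '' Icc 1 i)) :=
      FiniteDimensional.span_of_finite ℝ ((finite_Icc 1 i).image f)
    exact exists_orthogonal_inner_eq_infDist _ _
  choose g hg1 hg0 hgd using hex
  have hdet : innerDet (fun j : Fin n => g j) (fun i : Fin n => f (i + 1)) =
      ∏ i ∈ Finset.range n, infDist (f (i + 1)) (Submodule.span ℝ (f '' Icc 1 i) : Set H) := by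
    rw [innerDet_apply, Matrix.det_of_isLowerTriangular, ← Fin.prod_univ_eq_prod_range]
    · exact Finset.prod_congr rfl fun i _ => hgd i
    · intro i j hij
      refine hg0 _ _ (Submodule.subset_span ⟨_, ?_, rfl⟩)
      have : (i : ℕ) < j := by simpa using hij
      simp only [mem_Icc]
      omega
  rw [← hdet]
  exact (le_abs_self _).trans (abs_innerDet_le_of_finrank_le hmn (fun j => hg1 j) _ V hV hε hεR
    (fun i => hfR i) fun i => hfε i)

section Greedy

variable {F : Set H} {f : ℕ → H}

lemma IsGreedy.greedySigma_eq (hf : IsGreedy F f) (n : ℕ) :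
    greedySigma F f n = infDist (f (n + 1)) (Submodule.span ℝ (f '' Icc 1 n) : Set H) := by
  have hle : ∀ x, ⨆ _ : x ∈ F, infDist x (Submodule.span ℝ (f '' Icc 1 n) : Set H) ≤
      infDist (f (n + 1)) (Submodule.span ℝ (f '' Icc 1 n) : Set H) := fun x =>
    Real.iSup_le (fun hx => (hf n).2 x hx) infDist_nonneg
  refine le_antisymm (ciSup_le hle) ?_
  refine le_trans ?_ (le_ciSup ⟨_, forall_mem_range.2 hle⟩ (f (n + 1)))
  rw [ciSup_pos (hf n).1]

lemma greedySigma_nonneg (n : ℕ) : 0 ≤ greedySigma F f n :=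
  Real.iSup_nonneg fun _ => Real.iSup_nonneg fun _ => infDist_nonneg

lemma IsGreedy.antitone_greedySigma (hf : IsGreedy F f) : Antitone (greedySigma F f) := by
  refine antitone_nat_of_succ_le fun n => ?_
  rw [hf.greedySigma_eq, hf.greedySigma_eq]
  refine le_trans (infDist_le_infDist_of_subset ?_ ⟨0, Submodule.zero_mem _⟩)
    ((hf n).2 _ (hf (n + 1)).1)
  exact Submodule.span_mono (image_mono (Icc_subset_Icc_right n.le_succ))

lemma IsGreedy.norm_le (hf : IsGreedy F f) {x : H} (hx : x ∈ F) : ‖x‖ ≤ greedySigma F f 0 := by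
  rw [hf.greedySigma_eq]
  simpa using (hf 0).2 x hx

lemma kolWidth_nonneg (I : ℕ) : 0 ≤ kolWidth F I :=
  Real.iInf_nonneg fun _ => Real.iSup_nonneg fun _ => Real.iSup_nonneg fun _ => infDist_nonneg

lemma IsGreedy.exists_infDist_lt (hf : IsGreedy F f) {m : ℕ} {ε : ℝ} (h : kolWidth F m < ε) :
    ∃ V : Submodule ℝ H, FiniteDimensional ℝ V ∧ Module.finrank ℝ V ≤ m ∧
      ∀ x ∈ F, infDist x (V : Set H) < ε := by
  have : Nonempty {V : Submodule ℝ H // FiniteDimensional ℝ V ∧ Module.finrank ℝ V ≤ m} :=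
    ⟨⊥, inferInstance, by simp⟩
  obtain ⟨⟨V, hV, hVm⟩, hlt⟩ := exists_lt_of_ciInf_lt h
  refine ⟨V, hV, hVm, fun x hx => lt_of_le_of_lt ?_ hlt⟩
  have hbdd : BddAbove (range fun x : H => ⨆ _ : x ∈ F, infDist x (V : Set H)) := by
    refine ⟨greedySigma F f 0, forall_mem_range.2 fun x => ?_⟩
    exact Real.iSup_le (fun hx => (infDist_submodule_le_norm V x).trans (hf.norm_le hx))
      (greedySigma_nonneg 0)
  refine le_trans ?_ (le_ciSup hbdd x)
  rw [ciSup_pos hx]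

lemma IsGreedy.prod_greedySigma_le (hf : IsGreedy F f) {n m : ℕ} (hmn : m ≤ n) {ε : ℝ}
    (h : kolWidth F m < ε) :
    ∏ i ∈ Finset.range n, greedySigma F f i ≤
      2 ^ n * (n ! * (greedySigma F f 0 ^ m * ε ^ (n - m))) := by
  obtain ⟨V, hV, hVm, hVε⟩ := hf.exists_infDist_lt h
  have hε : 0 ≤ ε := (kolWidth_nonneg m).trans h.le
  have h0 : 0 ≤ greedySigma F f 0 := greedySigma_nonneg 0
  simp only [hf.greedySigma_eq]
  rw [← hf.greedySigma_eq 0]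
  refine (prod_infDist_span_le hmn f V hVm (le_min hε h0) (min_le_right ε _)
    (fun i => hf.norm_le (hf i).1) fun i => le_min (hVε _ (hf i).1).le
      ((infDist_submodule_le_norm V _).trans (hf.norm_le (hf i).1))).trans ?_
  gcongr
  exact min_le_left _ _

lemma IsGreedy.greedySigma_two_mul_sq_le (hf : IsGreedy F f) {m : ℕ} (hm : m ≠ 0) {ε : ℝ}
    (h : kolWidth F m < ε) :
    greedySigma F f (2 * m) ^ 2 ≤ (4 * m) ^ 2 * (greedySigma F f 0 * ε) := by
  have hε : 0 ≤ ε := (kolWidth_nonneg m).trans h.le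
  have h0 : 0 ≤ greedySigma F f 0 := greedySigma_nonneg 0
  refine le_of_pow_le_pow_left₀ hm (by positivity) ?_
  calc (greedySigma F f (2 * m) ^ 2) ^ m
      = ∏ i ∈ Finset.range (2 * m), greedySigma F f (2 * m) := by simp [pow_mul]
    _ ≤ ∏ i ∈ Finset.range (2 * m), greedySigma F f i :=
        Finset.prod_le_prod (fun _ _ => greedySigma_nonneg _) fun i hi =>
          hf.antitone_greedySigma (Finset.mem_range.1 hi).le
    _ ≤ 2 ^ (2 * m) * ((2 * m)! * (greedySigma F f 0 ^ m * ε ^ (2 * m - m))) :=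
        hf.prod_greedySigma_le (by omega) h
    _ ≤ 2 ^ (2 * m) * ((2 * m : ℝ) ^ (2 * m) * (greedySigma F f 0 ^ m * ε ^ (2 * m - m))) := by
        gcongr
        exact_mod_cast Nat.factorial_le_pow (2 * m)
    _ = ((4 * m) ^ 2 * (greedySigma F f 0 * ε)) ^ m := by
        rw [show 2 * m - m = m by omega, show (4 * m : ℝ) = 2 * (2 * m) by ring]
        simp only [mul_pow, pow_mul]
        ring

lemma IsGreedy.greedySigma_one_eq_zero (hf : IsGreedy F f) (h : kolWidth F 1 = 0) :
    greedySigma F f 1 = 0 := by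
  have h0 : 0 ≤ greedySigma F f 0 := greedySigma_nonneg 0
  have h1 : 0 ≤ greedySigma F f 1 := greedySigma_nonneg 1
  rcases h0.eq_or_lt with h0' | h0'
  · exact le_antisymm ((hf.antitone_greedySigma zero_le_one).trans h0'.ge) h1
  · refine le_antisymm (le_of_forall_pos_le_add fun ε hε => ?_) h1
    have h2 := hf.prod_greedySigma_le (n := 2) (m := 1) (by norm_num) (ε := ε / 8)
      (by rw [h]; positivity)
    simp only [Finset.prod_range_succ, Finset.prod_range_zero, one_mul] at h2
    norm_num at h2
    exact le_of_mul_le_mul_left (by linarith) h0'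

end Greedy

/-- A linear factor is absorbed by a stretched exponential. -/
lemma exists_le_mul_exp_rpow {c α : ℝ} (hc : 0 < c) (hα : 0 < α) :
    ∃ B : ℝ, 0 < B ∧ ∀ x : ℝ, 1 ≤ x → x ≤ B * Real.exp (c * x ^ α) := by
  obtain ⟨k, hk⟩ := exists_nat_ge (1 / α)
  have hk' : 1 ≤ α * k := by rwa [div_le_iff₀' hα] at hk
  refine ⟨k ! / c ^ k, by positivity, fun x hx => ?_⟩
  have hx0 : 0 ≤ x := zero_le_one.trans hx
  have h1 : x ≤ (x ^ α) ^ k := by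
    rw [← Real.rpow_natCast, ← Real.rpow_mul hx0]
    simpa using Real.rpow_le_rpow_of_exponent_le hx hk'
  have h2 := Real.pow_div_factorial_le_exp (x := c * x ^ α) (by positivity) k
  rw [div_le_iff₀ (by positivity), mul_pow] at h2
  rw [div_mul_eq_mul_div, le_div_iff₀ (by positivity)]
  calc x * c ^ k ≤ (x ^ α) ^ k * c ^ k := by gcongr
    _ ≤ k ! * Real.exp (c * x ^ α) := by linarith

end GreedyDecay

/-- If the Kolmogorov widths decay like `d₀ e^{−a I^α}`, then the greedy quantities decay like
`C d₀ e^{−c I^β}` for some constants `c, β, C > 0`. -/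
theorem greedy_exponential_decay
    {H : Type*} [NormedAddCommGroup H] [InnerProductSpace ℝ H]
    (F : Set H) (hF : IsCompact F) (f : ℕ → H) (hf : IsGreedy F f) :
    ∀ a α : ℝ, 0 < a → 0 < α →
      ∃ c β C : ℝ, 0 < c ∧ 0 < β ∧ 0 < C ∧
        ∀ d₀ : ℝ, 0 < d₀ →
          (∀ I : ℕ, 1 ≤ I → kolWidth F I ≤ d₀ * Real.exp (-a * (I : ℝ) ^ α)) →
          ∀ I : ℕ, 1 ≤ I → greedySigma F f I ≤ C * d₀ * Real.exp (-c * (I : ℝ) ^ β) := by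
  intro a α ha hα
  have hanti := hf.antitone_greedySigma
  have hnn : ∀ n, 0 ≤ greedySigma F f n := greedySigma_nonneg
  rcases (kolWidth_nonneg (F := F) 1).eq_or_lt with hk | hk
  · refine ⟨1, 1, 1, one_pos, one_pos, one_pos, fun d₀ hd _ I hI => ?_⟩
    refine ((hanti hI).trans (hf.greedySigma_one_eq_zero hk.symm).le).trans ?_
    positivity
  set K : ℝ := greedySigma F f 0 / kolWidth F 1 with hK
  have hK0 : 0 ≤ K := div_nonneg (hnn 0) hk.le
  set c : ℝ := a * (1 / 4) ^ α / 4 with hc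
  have hc0 : 0 < c := by positivity
  obtain ⟨B, hB, hBx⟩ := exists_le_mul_exp_rpow hc0 hα
  refine ⟨c, α, K * Real.exp c + (1 + 32 * K) * B, hc0, hα, by positivity,
    fun d₀ hd hw I hI => ?_⟩
  have hs0 : greedySigma F f 0 ≤ K * d₀ := by
    have h1 : kolWidth F 1 ≤ d₀ := by
      refine (hw 1 le_rfl).trans (mul_le_of_le_one_right hd.le ?_)
      simpa using ha.le
    rw [hK, div_mul_eq_mul_div, le_div_iff₀ hk]
    exact mul_le_mul_of_nonneg_left h1 (hnn 0)
  rcases hI.eq_or_lt with rfl | hI2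
  · calc greedySigma F f 1 ≤ K * d₀ := (hanti zero_le_one).trans hs0
      _ = K * Real.exp c * d₀ * Real.exp (-c * ((1 : ℕ) : ℝ) ^ α) := by
          have : Real.exp c * Real.exp (-c) = 1 := by rw [← Real.exp_add]; simp
          simp only [Nat.cast_one, Real.one_rpow, mul_one]
          linear_combination (-(K * d₀)) * this
      _ ≤ _ := by gcongr; exact le_add_of_nonneg_right (by positivity)
  · obtain ⟨m, hm2, hm4⟩ : ∃ m : ℕ, 2 * m ≤ I ∧ I ≤ 4 * m := ⟨I / 2, by omega, by omega⟩
    have hm0 : m ≠ 0 := by omega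
    have hmI : (4 * m : ℝ) ≤ 2 * I := by exact_mod_cast (by omega : 4 * m ≤ 2 * I)
    set E := Real.exp (-c * (I : ℝ) ^ α) with hE
    have hexp : Real.exp (-a * (m : ℝ) ^ α) ≤ E ^ 4 := by
      rw [hE, ← Real.exp_nat_mul, Real.exp_le_exp]
      have h1 : (1 / 4 : ℝ) ^ α * (I : ℝ) ^ α ≤ (m : ℝ) ^ α := by
        rw [← Real.mul_rpow (by norm_num) (by positivity)]
        have : (I : ℝ) ≤ 4 * m := by exact_mod_cast hm4
        exact Real.rpow_le_rpow (by positivity) (by linarith) hα.le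
      have h2 := mul_le_mul_of_nonneg_left h1 ha.le
      rw [hc]
      push_cast
      linarith
    have hε : kolWidth F m < 2 * d₀ * E ^ 4 := by
      have h1 := hw m (by omega)
      have h2 : d₀ * Real.exp (-a * (m : ℝ) ^ α) ≤ d₀ * E ^ 4 := by gcongr
      have h3 : 0 < d₀ * E ^ 4 := by positivity
      linarith
    have hIE : (I : ℝ) * E ≤ B := by
      have h1 := hBx I (by exact_mod_cast hI)
      rw [hE, neg_mul, Real.exp_neg, ← div_eq_mul_inv, div_le_iff₀ (Real.exp_pos _)]
      exact h1
    have h0 := hnn 0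
    have hsq : greedySigma F f (2 * m) ^ 2 ≤ ((1 + 32 * K) * B * d₀ * E) ^ 2 := by
      calc greedySigma F f (2 * m) ^ 2
          ≤ (4 * m) ^ 2 * (greedySigma F f 0 * (2 * d₀ * E ^ 4)) :=
            hf.greedySigma_two_mul_sq_le hm0 hε
        _ ≤ (2 * I) ^ 2 * (K * d₀ * (2 * d₀ * E ^ 4)) := by gcongr
        _ = 8 * K * (I * E) ^ 2 * (d₀ * E) ^ 2 := by ring
        _ ≤ (1 + 32 * K) ^ 2 * B ^ 2 * (d₀ * E) ^ 2 := by
            gcongr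
            nlinarith
        _ = _ := by ring
    calc greedySigma F f I ≤ greedySigma F f (2 * m) := hanti hm2
      _ ≤ (1 + 32 * K) * B * d₀ * E := le_of_pow_le_pow_left₀ two_ne_zero (by positivity) hsq
      _ ≤ _ := by gcongr; exact le_add_of_nonneg_left (by positivity)
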